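/- For the regular simplex P ⊂ ℝⁿ with diameter 1, the average distance M(P) from a point of P to its centroid satisfies M(P) ≤ √(n / (2(n+1)(n+2))) ≤ 1/√(2n), so M(P)/diam(P) → 0 as n → ∞ at rate O(n^{−1/2}). -/

import Mathlib

open MeasureTheory Set
lemma gram {n : ℕ} 
    (v : Fin (n + 1) → EuclideanSpace ℝ (Fin n))
    (hdist : ∀ i j, i ≠ j → dist (v i) (v j) = 1)
    (hcent : ∑ i, v i = 0) (i j : Fin (n+1)) :
    2 * inner ℝ (v i) (v j) + 1 / ((n:ℝ)+1) = if i = j then 1 else 0 := by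
  have h1 : ∀ i j, ‖v i‖^2 - 2 * inner ℝ (v i) (v j) + ‖v j‖^2 = if i = j then 0 else 1 := by
    intro i j
    rw [← norm_sub_sq_real]
    split_ifs with h
    · simp [h]
    · rw [← dist_eq_norm, hdist i j h]; norm_num
  have h0 : ∀ i, ∑ j, inner ℝ (v i) (v j) = 0 := by
    intro i; rw [← inner_sum, hcent, inner_zero_right]
  have h2 : ∀ i, ((n:ℝ)+1) * ‖v i‖^2 + ∑ j, ‖v j‖^2 = n := by
    intro i
    have := Finset.sum_congr rfl (fun j (_ : j ∈ Finset.univ) => h1 i j)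
    rw [Finset.sum_add_distrib, Finset.sum_sub_distrib, ← Finset.mul_sum, h0] at this
    have e : ∑ j : Fin (n+1), (if i = j then (0:ℝ) else 1) = n := by
      have : ∀ j : Fin (n+1), (if i = j then (0:ℝ) else 1) = 1 - if i = j then 1 else 0 := by
        intro j; split_ifs <;> norm_num
      simp only [this, Finset.sum_sub_distrib]; simp
    rw [e] at this
    simpa using this
  have h3 : ∑ j, ‖v j‖^2 = (n:ℝ)/2 := by
    have := Finset.sum_congr rfl (fun j (_ : j ∈ Finset.univ) => h2 j)
    rw [Finset.sum_add_distrib, ← Finset.mul_sum] at this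
    simp at this
    have hp : (n:ℝ)+1 ≠ 0 := by positivity
    have : ((n:ℝ)+1) * (2 * ∑ j, ‖v j‖^2 - n) = 0 := by linarith
    have := (mul_eq_zero.1 this).resolve_left hp
    linarith
  have h4 : ∀ i, ‖v i‖^2 = n / (2 * ((n:ℝ)+1)) := by
    intro i
    have := h2 i
    rw [h3] at this
    field_simp
    linarith
  have := h1 i j
  rw [h4, h4] at this
  have e : (n:ℝ) / (2 * ((n:ℝ)+1)) = 1/2 - 1/ ((n:ℝ)+1)/2 := by field_simp; ring
  rw [e] at this
  split_ifs at this ⊢ <;> linarith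

lemma beta (n : ℕ) : ∫⁻ t in Ioo (0:ℝ) 1, ENNReal.ofReal (t * (1-t)^n) = ENNReal.ofReal (1/((n+1)*(n+2))) := by
  rw [← ofReal_integral_eq_lintegral_ofReal]
  · congr 1
    rw [← integral_Ioc_eq_integral_Ioo, ← intervalIntegral.integral_of_le zero_le_one]
    have := intervalIntegral.integral_comp_sub_left (a := 0) (b := 1) (fun u : ℝ => (1-u) * u^n) 1
    simp only [sub_sub_cancel] at this
    rw [this]
    have e : ∀ u : ℝ, (1-u)*u^n = u^n - u^(n+1) := by intro u; ring
    simp only [e]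
    rw [intervalIntegral.integral_sub (by simp) (by simp)]
    simp
    field_simp; ring
  · exact (Continuous.integrableOn_Icc (by fun_prop)).mono_set Ioo_subset_Icc_self
  · refine (ae_restrict_iff' measurableSet_Ioo).2 (.of_forall fun t ht => ?_)
    have : 0 ≤ 1 - t := by linarith [ht.2]
    have := ht.1.le
    simp only [Pi.zero_apply]; positivity

lemma mem_hull {n : ℕ} (v : Fin (n + 1) → EuclideanSpace ℝ (Fin n)) (x : EuclideanSpace ℝ (Fin n))
    (hx : x ∈ convexHull ℝ (range v)) :
    ∃ w : Fin (n+1) → ℝ, (∀ i, 0 ≤ w i) ∧ ∑ i, w i = 1 ∧ ∑ i, w i • v i = x := by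
  have : convexHull ℝ (range v) ⊆
      {x | ∃ w : Fin (n+1) → ℝ, (∀ i, 0 ≤ w i) ∧ ∑ i, w i = 1 ∧ ∑ i, w i • v i = x} := by
    refine convexHull_min ?_ ?_
    · rintro _ ⟨i, rfl⟩
      refine ⟨fun j => if j = i then 1 else 0, fun j => ?_, by simp, by simp⟩
      dsimp only; split_ifs <;> norm_num
    · rintro _ ⟨w, h0, h1, rfl⟩ _ ⟨w', h0', h1', rfl⟩ a b ha hb hab
      refine ⟨fun i => a * w i + b * w' i, fun i => ?_, ?_, ?_⟩
      · have := h0 i; have := h0' i; positivity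
      · rw [Finset.sum_add_distrib, ← Finset.mul_sum, ← Finset.mul_sum, h1, h1']; linarith
      · simp only [add_smul, Finset.sum_add_distrib, mul_smul, Finset.smul_sum]
  exact this hx

lemma coord {n : ℕ} 
    (v : Fin (n + 1) → EuclideanSpace ℝ (Fin n))
    (hdist : ∀ i j, i ≠ j → dist (v i) (v j) = 1)
    (hcent : ∑ i, v i = 0) (w : Fin (n+1) → ℝ) (hw : ∑ i, w i = 1) (i : Fin (n+1)) :
    2 * inner ℝ (v i) (∑ j, w j • v j) + 1 / ((n:ℝ)+1) = w i := by
  have : ∀ j, inner ℝ (v i) (v j) = ((if i = j then 1 else 0) - 1 / ((n:ℝ)+1)) / 2 := by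
    intro j
    rw [← gram v hdist hcent i j]; ring
  simp only [inner_sum, inner_smul_right, this]
  have e : ∀ j, w j * (((if i = j then 1 else 0) - 1 / ((n:ℝ)+1)) / 2) =
    (if i = j then w j else 0) / 2 - w j * (1 / ((n:ℝ)+1) / 2) := by
    intro j; split_ifs <;> ring
  simp only [e, Finset.sum_sub_distrib, ← Finset.sum_div, ← Finset.sum_mul, hw]
  simp
  ring

lemma level {n : ℕ} 
    (v : Fin (n + 1) → EuclideanSpace ℝ (Fin n))
    (hdist : ∀ i j, i ≠ j → dist (v i) (v j) = 1)
    (hcent : ∑ i, v i = 0) (i : Fin (n+1)) (s : ℝ) (h1 : s < 1) :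
    volume ({x | s ≤ 2 * inner ℝ (v i) x + 1 / ((n:ℝ)+1)} ∩ convexHull ℝ (range v)) ≤
      ENNReal.ofReal ((1-s)^n) * volume (convexHull ℝ (range v)) := by
  have hs : 0 < 1 - s := by linarith
  have := Measure.addHaar_image_homothety volume (v i) (1-s) (convexHull ℝ (range v))
  rw [finrank_euclideanSpace_fin, abs_of_pos (by positivity)] at this
  rw [← this]
  apply measure_mono
  rintro x ⟨hx, hxP⟩
  obtain ⟨w, w0, w1, rfl⟩ := mem_hull v x hxP
  rw [mem_ofPred_eq, coord v hdist hcent w w1] at hx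
  have w1' : ∑ j, (w j - if j = i then s else 0) / (1-s) = 1 := by
    rw [← Finset.sum_div, Finset.sum_sub_distrib, w1]
    simp [hs.ne']
  refine ⟨∑ j, ((w j - if j = i then s else 0) / (1-s)) • v j, ?_, ?_⟩
  · refine (convex_convexHull ℝ (range v)).sum_mem (fun j _ => ?_) w1'
      (fun j _ => subset_convexHull ℝ _ ⟨j, rfl⟩)
    refine div_nonneg ?_ hs.le
    split_ifs with h
    · subst h; linarith
    · simpa using w0 j
  · rw [AffineMap.homothety_apply, vsub_eq_sub, vadd_eq_add, smul_sub, Finset.smul_sum]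
    simp only [smul_smul, mul_div_cancel₀ _ hs.ne', sub_smul, Finset.sum_sub_distrib, ite_smul, zero_smul]
    simp

lemma second {n : ℕ} 
    (v : Fin (n + 1) → EuclideanSpace ℝ (Fin n))
    (hdist : ∀ i j, i ≠ j → dist (v i) (v j) = 1)
    (hcent : ∑ i, v i = 0) (i : Fin (n+1)) :
    ∫ x in convexHull ℝ (range v), (2 * inner ℝ (v i) x + 1 / ((n:ℝ)+1))^2 ≤
      2 / ((n+1)*(n+2)) * (volume (convexHull ℝ (range v))).toReal := by
  have hc : IsCompact (convexHull ℝ (range v)) := (finite_range v).isCompact_convexHull ℝ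
  have hm := hc.measurableSet
  have hV : volume (convexHull ℝ (range v)) ≠ ⊤ := hc.measure_lt_top.ne
  have hfc : Continuous fun x => 2 * inner ℝ (v i) x + 1 / ((n:ℝ)+1) := by fun_prop
  have hnn : 0 ≤ᵐ[volume.restrict (convexHull ℝ (range v))]
      fun x => 2 * inner ℝ (v i) x + 1 / ((n:ℝ)+1) := by
    refine (ae_restrict_iff' hm).2 (.of_forall fun x hx => ?_)
    obtain ⟨w, w0, w1, rfl⟩ := mem_hull v x hx
    simpa only [Pi.zero_apply, coord v hdist hcent w w1] using w0 i
  have key := lintegral_rpow_eq_lintegral_meas_le_mul (volume.restrict (convexHull ℝ (range v)))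
    hnn hfc.aemeasurable (p := 2) (by norm_num)
  have bd : ∫⁻ t in Ioi (0:ℝ), (volume.restrict (convexHull ℝ (range v)))
      {x | t ≤ 2 * inner ℝ (v i) x + 1 / ((n:ℝ)+1)} * ENNReal.ofReal (t ^ ((2:ℝ) - 1)) ≤
      ENNReal.ofReal (1/((n+1)*(n+2))) * volume (convexHull ℝ (range v)) := by
    rw [← beta, ← lintegral_mul_const' _ _ hV, ← lintegral_indicator measurableSet_Ioo,
      ← lintegral_indicator measurableSet_Ioi]
    have hae : ∀ᵐ t : ℝ, t ≠ 1 := by simp [ae_iff]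
    refine lintegral_mono_ae ?_
    filter_upwards [hae] with t ht
    by_cases h0 : 0 < t
    swap
    · simp [h0]
    rw [indicator_of_mem (mem_Ioi.2 h0), Measure.restrict_apply' hm]
    norm_num only [Real.rpow_one]
    rcases lt_or_gt_of_ne ht with h1 | h1
    · rw [indicator_of_mem (mem_Ioo.2 ⟨h0, h1⟩), ENNReal.ofReal_mul h0.le, mul_comm, mul_assoc]
      gcongr
      exact level v hdist hcent i t h1
    · have : {x | t ≤ 2 * inner ℝ (v i) x + 1 / ((n:ℝ)+1)} ∩ convexHull ℝ (range v) = ∅ := by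
        ext x
        simp only [mem_inter_iff, mem_ofPred_eq, mem_empty_iff_false, iff_false, not_and]
        intro hx hxP
        obtain ⟨w, w0, w1, rfl⟩ := mem_hull v x hxP
        rw [coord v hdist hcent w w1] at hx
        have := Finset.single_le_sum (fun j _ => w0 j) (Finset.mem_univ i)
        linarith
      norm_num only at this
      rw [this]; simp
  rw [integral_eq_lintegral_of_nonneg_ae (.of_forall fun x => sq_nonneg _)
    (by exact (hfc.pow 2).aestronglyMeasurable)]
  refine ENNReal.toReal_le_of_le_ofReal (by positivity) ?_
  simp only [Real.rpow_two] at key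
  rw [key]
  refine (mul_le_mul_right bd _).trans ?_
  rw [ENNReal.ofReal_mul (by positivity), ENNReal.ofReal_toReal hV, ← mul_assoc,
    ← ENNReal.ofReal_mul (by norm_num), mul_one_div]

/-- For the regular simplex `P ⊂ ℝⁿ` with diameter 1 (centroid at the origin), the
average distance to the centroid satisfies
`M(P) ≤ √(n/(2(n+1)(n+2))) ≤ 1/√(2n)`, so `M(P)/diam(P) = O(n^{-1/2})`. -/
theorem stmt_10 (n : ℕ) (hn : 0 < n)
    (v : Fin (n + 1) → EuclideanSpace ℝ (Fin n))
    (hdist : ∀ i j, i ≠ j → dist (v i) (v j) = 1)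
    (hcent : ∑ i, v i = 0)
    (P : Set (EuclideanSpace ℝ (Fin n)))
    (hP : P = convexHull ℝ (range v)) :
    (volume P).toReal⁻¹ * ∫ x in P, ‖x‖ ≤
        Real.sqrt ((n : ℝ) / (2 * (n + 1) * (n + 2))) ∧
      Real.sqrt ((n : ℝ) / (2 * (n + 1) * (n + 2))) ≤ 1 / Real.sqrt (2 * n) := by
  have hn' : (0:ℝ) < n := by exact_mod_cast hn
  constructor
  swap
  · rw [one_div, ← Real.sqrt_inv]
    apply Real.sqrt_le_sqrt
    rw [← one_div, div_le_div_iff₀ (by positivity) (by positivity)]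
    nlinarith
  have hc : IsCompact P := hP ▸ (finite_range v).isCompact_convexHull ℝ
  set C : ℝ := (n : ℝ) / (2 * (n + 1) * (n + 2)) with hC
  have hCpos : 0 < C := by positivity
  set V := (volume P).toReal with hVdef
  have hV0 : 0 ≤ V := ENNReal.toReal_nonneg
  have hint : ∀ f : EuclideanSpace ℝ (Fin n) → ℝ, Continuous f → IntegrableOn f P volume :=
    fun f hf => hf.continuousOn.integrableOn_compact hc
  have hconst : ∀ a : ℝ, ∫ _ in P, a = V * a := by
    intro a; rw [setIntegral_const, smul_eq_mul]; rfl
  have hsq : ∫ x in P, ‖x‖^2 ≤ C * V := by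
    have e : ∀ x ∈ P, ‖x‖^2 =
        (∑ i, (2 * inner ℝ (v i) x + 1 / ((n:ℝ)+1))^2) / 2 - 1 / (2 * ((n:ℝ)+1)) := by
      intro x hx
      rw [hP] at hx
      obtain ⟨w, w0, w1, hx⟩ := mem_hull v x hx
      have hco : ∀ i, 2 * inner ℝ (v i) x + 1 / ((n:ℝ)+1) = w i :=
        fun i => hx ▸ coord v hdist hcent w w1 i
      simp only [hco]
      have : ‖x‖^2 = ∑ i, w i * ((w i - 1 / ((n:ℝ)+1)) / 2) := by
        rw [← real_inner_self_eq_norm_sq]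
        nth_rw 1 [← hx]
        rw [sum_inner]
        refine Finset.sum_congr rfl fun i _ => ?_
        rw [real_inner_smul_left, ← hco i]; ring
      rw [this]
      have e2 : ∀ i, w i * ((w i - 1 / ((n:ℝ)+1)) / 2) = w i ^2 / 2 - w i * (1 / (2 * ((n:ℝ)+1))) := by
        intro i; field_simp
      simp only [e2, Finset.sum_sub_distrib, ← Finset.sum_mul, w1, ← Finset.sum_div, one_mul]
    rw [setIntegral_congr_fun hc.measurableSet e, integral_sub (hint _ (by fun_prop)) (hint _ (by fun_prop)),
      integral_div, integral_finsetSum _ (fun i _ => hint _ (by fun_prop)), hconst]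
    have := Finset.sum_le_sum (fun i (_ : i ∈ Finset.univ) => second v hdist hcent i)
    rw [← hP] at this
    rw [Finset.sum_const, Finset.card_univ, Fintype.card_fin, nsmul_eq_mul] at this
    have e3 : C * V = (((n+1:ℕ):ℝ) * (2 / ((n+1)*(n+2)) * V)) / 2 - V * (1 / (2 * ((n:ℝ)+1))) := by
      rw [hC]; push_cast; field_simp; ring
    rw [e3]
    linarith
  have hle : ∫ x in P, ‖x‖ ≤ V * √C := by
    have hs : 0 < √C := Real.sqrt_pos.2 hCpos
    calc ∫ x in P, ‖x‖ ≤ ∫ x in P, (‖x‖^2 / (2 * √C) + √C/2) := by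
          refine integral_mono (hint _ (by fun_prop)) (hint _ (by fun_prop)) fun x => ?_
          have : ‖x‖^2 / (2 * √C) + √C/2 - ‖x‖ = (‖x‖ - √C)^2 / (2 * √C) := by
            field_simp; ring
          have h2 : 0 ≤ (‖x‖ - √C)^2 / (2 * √C) := by positivity
          dsimp only
          linarith
      _ = (∫ x in P, ‖x‖^2) / (2 * √C) + V * (√C/2) := by
          rw [integral_add (hint _ (by fun_prop)) (hint _ (by fun_prop)), integral_div, hconst]
      _ ≤ (C * V) / (2 * √C) + V * (√C/2) := by gcongr
      _ = V * √C := by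
          have : C = √C * √C := (Real.mul_self_sqrt hCpos.le).symm
          nth_rw 1 [this]
          field_simp; ring
  rcases hV0.eq_or_lt with h | h
  · rw [← h]; simp
  · rw [inv_mul_le_iff₀ h]; exact hle
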